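/- arXiv:1512.04188 — 3 statements merged into one kernel-verified Lean document; each statement's English description precedes it below -/
import Mathlib

section
/- For all integers n ≥ 2 and v ≥ n, (C(⌈v/2⌉, n) + C(⌊v/2⌋, n)) / C(v, n) ≤ 2^{−(n−1)} · exp(−(n−1)²/(2v)). -/
theorem cast_choose_succ_mul (m k : ℕ) :
    (m.choose (k + 1) : ℝ) * (k + 1) = m.choose k * ((m : ℝ) - k) := by
  rcases le_or_gt k m with h | h
  · have := Nat.choose_succ_right_eq m k
    rw [← Nat.cast_sub h]
    exact_mod_cast this
  · simp [Nat.choose_eq_zero_of_lt h, Nat.choose_eq_zero_of_lt (Nat.lt_succ_of_lt h)]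

theorem two_pow_mul_choose_le (m k : ℕ) :
    (2 : ℝ) ^ k * m.choose k ≤
      (2 * m).choose k * Real.exp (-((k : ℝ) * (k - 1)) / (4 * m)) := by
  induction k with
  | zero => simp
  | succ k ih =>
    rcases le_or_gt m k with h | h
    · rw [Nat.choose_eq_zero_of_lt (Nat.lt_succ_of_le h)]
      simp only [Nat.cast_zero, mul_zero]
      positivity
    · have hm : (0 : ℝ) < m := by exact_mod_cast Nat.zero_lt_of_lt h
      have hkm : (k : ℝ) < m := by exact_mod_cast h
      have hk : (0 : ℝ) ≤ k := k.cast_nonneg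
      have h1 := cast_choose_succ_mul m k
      have h2 := cast_choose_succ_mul (2 * m) k
      push_cast at h2
      have hexp : 1 - (k : ℝ) / (2 * m) ≤ Real.exp (-((k : ℝ) / (2 * m))) :=
        Real.one_sub_le_exp_neg _
      have hfactor : 2 * ((m : ℝ) - k) ≤ (2 * m - k) * Real.exp (-((k : ℝ) / (2 * m))) := by
        refine le_trans ?_ (mul_le_mul_of_nonneg_left hexp (by linarith))
        have : (2 * (m : ℝ) - k) * (1 - k / (2 * m)) = 2 * (m - k) + k ^ 2 / (2 * m) := by
          field_simp
          ring
        rw [this]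
        have : 0 ≤ (k : ℝ) ^ 2 / (2 * m) := by positivity
        linarith
      have hsplit : Real.exp (-(((k + 1 : ℕ) : ℝ) * ((k + 1 : ℕ) - 1)) / (4 * m)) =
          Real.exp (-((k : ℝ) * (k - 1)) / (4 * m)) * Real.exp (-((k : ℝ) / (2 * m))) := by
        rw [← Real.exp_add]
        congr 1
        push_cast
        field_simp
        ring
      rw [hsplit]
      refine le_of_mul_le_mul_right ?_ (by positivity : (0 : ℝ) < k + 1)
      calc (2 : ℝ) ^ (k + 1) * m.choose (k + 1) * (k + 1)
          = 2 ^ k * m.choose k * (2 * (m - k)) := by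
            rw [mul_assoc, h1]
            ring
        _ ≤ (2 * m).choose k * Real.exp (-((k : ℝ) * (k - 1)) / (4 * m)) *
              ((2 * m - k) * Real.exp (-((k : ℝ) / (2 * m)))) :=
            mul_le_mul ih hfactor (by linarith) (by positivity)
        _ = (2 * m).choose k * (2 * m - k) * (Real.exp (-((k : ℝ) * (k - 1)) / (4 * m)) *
              Real.exp (-((k : ℝ) / (2 * m)))) := by ring
        _ = _ := by
            rw [← h2]
            ring

theorem two_pow_mul_choose_add_choose_le (m k : ℕ) (hm : 0 < m) (hk : k ≤ 2 * m) :
    (2 : ℝ) ^ k * ((m + 1).choose (k + 1) + m.choose (k + 1)) ≤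
      (2 * m + 1).choose (k + 1) * Real.exp (-(k : ℝ) ^ 2 / (2 * (2 * m + 1))) := by
  have hm' : (0 : ℝ) < m := by exact_mod_cast hm
  have hk' : (k : ℝ) ≤ 2 * m := by exact_mod_cast hk
  have h1 := cast_choose_succ_mul m k
  have h2 : ((m : ℝ) + 1) * m.choose k = (m + 1).choose (k + 1) * (k + 1) := by
    exact_mod_cast Nat.add_one_mul_choose_eq m k
  have h3 : (2 * (m : ℝ) + 1) * (2 * m).choose k = (2 * m + 1).choose (k + 1) * (k + 1) := by
    exact_mod_cast Nat.add_one_mul_choose_eq (2 * m) k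
  have hfactor : 2 * (m : ℝ) + 1 - k ≤
      (2 * m + 1) * Real.exp (-((k : ℝ) / (2 * m + 1))) := by
    refine le_trans (le_of_eq ?_) (mul_le_mul_of_nonneg_left
      (Real.one_sub_le_exp_neg _) (by positivity))
    field_simp
  have hexp : Real.exp (-((k : ℝ) * (k - 1)) / (4 * m)) * Real.exp (-((k : ℝ) / (2 * m + 1))) ≤
      Real.exp (-(k : ℝ) ^ 2 / (2 * (2 * m + 1))) := by
    rw [← Real.exp_add]
    apply Real.exp_le_exp.mpr
    have hkk : (0 : ℝ) ≤ k * (k - 1) := by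
      rcases k with _ | k
      · simp
      · push_cast
        rw [add_sub_cancel_right]
        positivity
    have hle : (k : ℝ) * (k - 1) / (2 * (2 * m + 1)) ≤ k * (k - 1) / (4 * m) :=
      div_le_div_of_nonneg_left hkk (by positivity) (by linarith)
    have hsum : (k : ℝ) ^ 2 / (2 * (2 * m + 1)) + k / (2 * (2 * m + 1)) =
        k * (k - 1) / (2 * (2 * m + 1)) + k / (2 * m + 1) := by
      field_simp
      ring
    have hpos : (0 : ℝ) ≤ k / (2 * (2 * m + 1)) := by positivity
    rw [neg_div, neg_div]
    linarith
  refine le_of_mul_le_mul_right ?_ (by positivity : (0 : ℝ) < k + 1)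
  calc (2 : ℝ) ^ k * ((m + 1).choose (k + 1) + m.choose (k + 1)) * (k + 1)
      = 2 ^ k * m.choose k * (2 * m + 1 - k) := by
        linear_combination (2 : ℝ) ^ k * (h1 - h2)
    _ ≤ (2 * m).choose k * Real.exp (-((k : ℝ) * (k - 1)) / (4 * m)) *
          ((2 * m + 1) * Real.exp (-((k : ℝ) / (2 * m + 1)))) :=
        mul_le_mul (two_pow_mul_choose_le m k) hfactor (by linarith) (by positivity)
    _ = (2 * m + 1).choose (k + 1) * (k + 1) * (Real.exp (-((k : ℝ) * (k - 1)) / (4 * m)) *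
          Real.exp (-((k : ℝ) / (2 * m + 1)))) := by
        rw [← h3]
        ring
    _ ≤ (2 * m + 1).choose (k + 1) * (k + 1) * Real.exp (-(k : ℝ) ^ 2 / (2 * (2 * m + 1))) :=
        mul_le_mul_of_nonneg_left hexp (by positivity)
    _ = _ := by ring

/-- For `n ≥ 2` and `v ≥ n`, the probability that a fixed `n`-set is monochromatic
under a uniformly random balanced two-coloring of `[v]` satisfies
`(C(⌈v/2⌉,n) + C(⌊v/2⌋,n)) / C(v,n) ≤ 2^(-(n-1)) * exp(-(n-1)²/(2v))`. -/
theorem mono_probability_bound (n v : ℕ) (hn : 2 ≤ n) (hv : n ≤ v) :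
    ((((v + 1) / 2).choose n + (v / 2).choose n : ℝ)) / (v.choose n) ≤
      ((2 : ℝ) ^ (n - 1))⁻¹ * Real.exp (-((n : ℝ) - 1) ^ 2 / (2 * v)) := by
  have hpos : (0 : ℝ) < v.choose n := by exact_mod_cast Nat.choose_pos hv
  obtain ⟨k, rfl⟩ : ∃ k, n = k + 1 := ⟨n - 1, by omega⟩
  rw [div_le_iff₀ hpos, mul_assoc, inv_mul_eq_div, le_div_iff₀ (by positivity),
    Nat.add_sub_cancel, Nat.cast_add_one, add_sub_cancel_right, mul_comm, mul_comm (Real.exp _)]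
  obtain ⟨m, rfl | rfl⟩ := Nat.even_or_odd' v
  · rw [show (2 * m + 1) / 2 = m by omega, show 2 * m / 2 = m by omega]
    calc (2 : ℝ) ^ k * (m.choose (k + 1) + m.choose (k + 1))
        = 2 ^ (k + 1) * m.choose (k + 1) := by ring
      _ ≤ _ := two_pow_mul_choose_le m (k + 1)
      _ ≤ _ := by
        refine mul_le_mul_of_nonneg_left (Real.exp_le_exp.mpr ?_) hpos.le
        have hk : (0 : ℝ) ≤ k := k.cast_nonneg
        push_cast
        rw [show 2 * (2 * (m : ℝ)) = 4 * m by ring]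
        gcongr
        nlinarith
  · rw [show (2 * m + 1 + 1) / 2 = m + 1 by omega, show (2 * m + 1) / 2 = m by omega]
    push_cast
    exact two_pow_mul_choose_add_choose_le m k (by omega) (by omega)
end

section
/- Let n ≥ 100 and q ≥ 1 be integers. Let L be a set of two-colorings of [n²] with the property that for every n-uniform hypergraph H on [n²] with at most q hyperedges there is some χ ∈ L that is valid for H. Then |Δ(L)| ≥ (q/(10·n²·2^n)) · C(n², n). -/
open Classical

/-- If every point of `L` is related to at least `M` points of `D`, then for every `k` some at most
`k` points of `D` leave at most a `(1 - M / #D) ^ k` fraction of `L` unrelated to all of them. -/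
theorem exists_small_subset_few_unrelated {α β : Type*} (r : α → β → Prop) (L : Finset α)
    (D : Finset β) (M : ℕ) (hD : D.Nonempty) (hMD : M ≤ D.card)
    (h : ∀ a ∈ L, M ≤ (D.filter (fun b => r a b)).card) (k : ℕ) :
    ∃ E ⊆ D, E.card ≤ k ∧
      ((L.filter (fun a => ∀ b ∈ E, ¬ r a b)).card : ℝ) * (D.card : ℝ) ^ k ≤
        ((D.card : ℝ) - M) ^ k * L.card := by
  induction k with
  | zero => exact ⟨∅, by simp, by simp, by simp⟩
  | succ k ih =>
    obtain ⟨E, hED, hEk, hE⟩ := ih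
    set L' := L.filter (fun a => ∀ b ∈ E, ¬ r a b) with hL'
    have hcount : L'.card * M ≤ ∑ b ∈ D, (L'.filter (fun a => r a b)).card := by
      refine le_of_le_of_eq ?_
        (Finset.sum_card_bipartiteAbove_eq_sum_card_bipartiteBelow (s := L') (t := D) r)
      rw [← smul_eq_mul]
      exact Finset.card_nsmul_le_sum _ _ _ fun a ha => h a (Finset.mem_filter.1 ha).1
    obtain ⟨b, hbD, hb⟩ : ∃ b ∈ D, L'.card * M ≤ D.card * (L'.filter (fun a => r a b)).card := by
      refine Finset.exists_le_of_sum_le hD ?_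
      rw [Finset.sum_const, smul_eq_mul, ← Finset.mul_sum]
      exact Nat.mul_le_mul_left _ hcount
    refine ⟨insert b E, Finset.insert_subset hbD hED,
      (Finset.card_insert_le _ _).trans (by omega), ?_⟩
    have hsplit : L.filter (fun a => ∀ c ∈ insert b E, ¬ r a c) =
        L'.filter (fun a => ¬ r a b) := by
      ext a
      simp only [hL', Finset.mem_filter, Finset.mem_insert, forall_eq_or_imp]
      tauto
    have hcard := Finset.card_filter_add_card_filter_not (s := L') (fun a => r a b)
    rw [hsplit]
    have hcard' : ((L'.filter (fun a => r a b)).card : ℝ) +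
        (L'.filter (fun a => ¬ r a b)).card = L'.card := by exact_mod_cast hcard
    have hb' : (L'.card : ℝ) * M ≤ D.card * (L'.filter (fun a => r a b)).card := by
      exact_mod_cast hb
    have hMD' : (M : ℝ) ≤ D.card := by exact_mod_cast hMD
    have hstep : ((L'.filter (fun a => ¬ r a b)).card : ℝ) * D.card ≤
        ((D.card : ℝ) - M) * L'.card := by
      rw [← eq_sub_iff_add_eq'] at hcard'
      rw [hcard']
      linarith
    calc ((L'.filter (fun a => ¬ r a b)).card : ℝ) * (D.card : ℝ) ^ (k + 1)
        = ((L'.filter (fun a => ¬ r a b)).card : ℝ) * D.card * (D.card : ℝ) ^ k := by ring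
      _ ≤ ((D.card : ℝ) - M) * L'.card * (D.card : ℝ) ^ k := by gcongr
      _ = ((D.card : ℝ) - M) * (L'.card * (D.card : ℝ) ^ k) := by ring
      _ ≤ ((D.card : ℝ) - M) * (((D.card : ℝ) - M) ^ k * L.card) :=
          mul_le_mul_of_nonneg_left hE (by linarith)
      _ = ((D.card : ℝ) - M) ^ (k + 1) * L.card := by ring

theorem card_pow_le_of_forall_exists_unrelated {α β : Type*} (r : α → β → Prop) (L : Finset α)
    (D : Finset β) (M : ℕ) (hD : D.Nonempty) (hMD : M ≤ D.card)
    (h : ∀ a ∈ L, M ≤ (D.filter (fun b => r a b)).card) (k : ℕ)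
    (hk : ∀ E ⊆ D, E.card ≤ k → ∃ a ∈ L, ∀ b ∈ E, ¬ r a b) :
    (D.card : ℝ) ^ k ≤ ((D.card : ℝ) - M) ^ k * L.card := by
  obtain ⟨E, hED, hEk, hE⟩ := exists_small_subset_few_unrelated r L D M hD hMD h k
  obtain ⟨a, ha, hr⟩ := hk E hED hEk
  refine le_trans (le_mul_of_one_le_left (by positivity) ?_) hE
  exact Nat.one_le_cast.2 (Finset.card_pos.2 ⟨a, Finset.mem_filter.2 ⟨ha, hr⟩⟩)

theorem descFactorial_mul_le_two_pow_mul_descFactorial {n m k : ℕ} (hn : 2 ≤ n)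
    (hm : n ^ 2 ≤ 2 * m) (hk : k ≤ n) :
    ((n ^ 2).descFactorial k : ℝ) * (1 - (k : ℝ) * (k - 1) / (2 * (n * (n - 1)))) ≤
      2 ^ k * (m.descFactorial k : ℝ) := by
  induction k with
  | zero => simp
  | succ k ih =>
    have ih := ih (by omega)
    have hnm : n ≤ m := by nlinarith
    have hnn : n ≤ n ^ 2 := by nlinarith
    rw [Nat.descFactorial_succ, Nat.descFactorial_succ, Nat.cast_mul, Nat.cast_mul,
      Nat.cast_sub (by omega), Nat.cast_sub (by omega)]
    push_cast
    have hm' : (n : ℝ) ^ 2 ≤ 2 * m := by exact_mod_cast hm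
    have hk' : (k : ℝ) + 1 ≤ n := by exact_mod_cast hk
    have hn' : (2 : ℝ) ≤ n := by exact_mod_cast hn
    have hk0 : (0 : ℝ) ≤ k := by positivity
    set A : ℝ := ((n ^ 2).descFactorial k : ℝ)
    set B : ℝ := (m.descFactorial k : ℝ)
    have hA : 0 ≤ A := by positivity
    have hB : 0 ≤ 2 ^ k * B := by positivity
    set d : ℝ := n * (n - 1) with hd
    have hd0 : 0 < d := by apply mul_pos <;> linarith
    set c : ℝ := 1 - (k : ℝ) * (k - 1) / (2 * d) with hc
    have hc' : 1 - ((k : ℝ) + 1) * (k + 1 - 1) / (2 * d) = c - k / d := by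
      rw [hc]; field_simp; ring
    have hkk : (0 : ℝ) ≤ (k : ℝ) * (k - 1) := by
      rcases Nat.eq_zero_or_pos k with h | h
      · simp [h]
      · have : (1 : ℝ) ≤ k := by exact_mod_cast h
        exact mul_nonneg hk0 (by linarith)
    have hc1 : c ≤ 1 := by
      have : 0 ≤ (k : ℝ) * (k - 1) / (2 * d) := by positivity
      linarith
    have hkd : (k : ℝ) ≤ ((n : ℝ) ^ 2 - k) * (k / d) := by
      rw [← mul_div_assoc, le_div_iff₀ hd0]
      nlinarith
    have h2k : (0 : ℝ) ≤ (n : ℝ) ^ 2 - 2 * k := by nlinarith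
    rw [hc']
    calc ((n : ℝ) ^ 2 - k) * A * (c - k / d)
        = A * (((n : ℝ) ^ 2 - k) * c - ((n : ℝ) ^ 2 - k) * (k / d)) := by ring
      _ ≤ A * (((n : ℝ) ^ 2 - 2 * k) * c) := by
          refine mul_le_mul_of_nonneg_left ?_ hA
          nlinarith
      _ = ((n : ℝ) ^ 2 - 2 * k) * (A * c) := by ring
      _ ≤ ((n : ℝ) ^ 2 - 2 * k) * (2 ^ k * B) := mul_le_mul_of_nonneg_left ih h2k
      _ ≤ (2 * m - 2 * k) * (2 ^ k * B) := by gcongr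
      _ = 2 ^ (k + 1) * ((m - k) * B) := by ring

theorem choose_sq_le_two_pow_mul_choose {n m : ℕ} (hn : 2 ≤ n) (hm : n ^ 2 ≤ 2 * m) :
    ((n ^ 2).choose n : ℝ) ≤ 2 * 2 ^ n * (m.choose n : ℝ) := by
  have h := descFactorial_mul_le_two_pow_mul_descFactorial hn hm le_rfl
  have hn' : (2 : ℝ) ≤ n := by exact_mod_cast hn
  have hd : (n : ℝ) * (n - 1) ≠ 0 := (mul_pos (by linarith) (by linarith)).ne'
  have hhalf : 1 - (n : ℝ) * (n - 1) / (2 * (n * (n - 1))) = 1 / 2 := by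
    rw [mul_comm 2, ← div_div, div_self hd]; norm_num
  rw [hhalf, Nat.descFactorial_eq_factorial_mul_choose,
    Nat.descFactorial_eq_factorial_mul_choose, Nat.cast_mul, Nat.cast_mul] at h
  have hf : (0 : ℝ) < n.factorial := by exact_mod_cast n.factorial_pos
  refine le_of_mul_le_mul_left ?_ hf
  linarith

theorem choose_le_card_monochromatic {N : ℕ} (n : ℕ) (χ : Fin N → Bool) :
    ((N + 1) / 2).choose n ≤
      (((Finset.univ : Finset (Fin N)).powersetCard n).filter
        (fun e => ∀ x ∈ e, ∀ y ∈ e, χ x = χ y)).card := by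
  obtain ⟨c, hc⟩ : ∃ c, (N + 1) / 2 ≤ (Finset.univ.filter (fun x => χ x = c)).card := by
    by_contra! hcon
    have h1 := hcon true
    have h2 := hcon false
    have h3 := Finset.card_filter_add_card_filter_not (s := Finset.univ) (fun x => χ x = true)
    simp only [Bool.not_eq_true, Finset.card_univ, Fintype.card_fin] at h3
    omega
  refine (Nat.choose_le_choose n hc).trans ?_
  rw [← Finset.card_powersetCard]
  refine Finset.card_le_card fun e he => ?_
  rw [Finset.mem_powersetCard] at he
  refine Finset.mem_filter.2 ⟨Finset.mem_powersetCard.2 ⟨Finset.subset_univ _, he.2⟩, ?_⟩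
  intro x hx y hy
  rw [(Finset.mem_filter.1 (he.1 hx)).2, (Finset.mem_filter.1 (he.1 hy)).2]

theorem mul_le_mul_of_pow_le_sub_pow_mul_two_pow {D M : ℝ} {q N : ℕ} (hD : 0 < D) (hMD : M ≤ D)
    (h : D ^ q ≤ (D - M) ^ q * 2 ^ N) : q * M ≤ N * D := by
  have h1 : (D - M) ^ q ≤ (D * Real.exp (-(M / D))) ^ q := by
    refine pow_le_pow_left₀ (by linarith) ?_ q
    calc D - M = D * (-(M / D) + 1) := by field_simp; ring
      _ ≤ _ := mul_le_mul_of_nonneg_left (Real.add_one_le_exp _) hD.le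
  have h2 : (2 : ℝ) ^ N ≤ Real.exp 1 ^ N :=
    pow_le_pow_left₀ (by norm_num) (by linarith [Real.add_one_le_exp 1]) N
  have h3 : D ^ q * 1 ≤ D ^ q * Real.exp (q * -(M / D) + N * 1) := by
    rw [Real.exp_add, Real.exp_nat_mul, Real.exp_nat_mul, ← mul_assoc, ← mul_pow, mul_one]
    exact h.trans (mul_le_mul h1 h2 (by positivity) (by positivity))
  have h4 := Real.one_le_exp_iff.1 (le_of_mul_le_mul_left h3 (by positivity))
  have h5 : q * (M / D) ≤ N := by linarith
  rwa [← mul_div_assoc, div_le_iff₀ hD] at h5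

/-- **Claim 2 (paper)**: if a set `L` of two-colorings of `[n²]` contains a valid
coloring for every `n`-uniform hypergraph on `[n²]` with at most `q` hyperedges, then
the shadow of `L` has size at least `(q/(10·n²·2^n))·C(n²,n)`. -/
theorem shadow_union_lower_bound (n q : ℕ) (hn : 100 ≤ n) (hq : 1 ≤ q)
    (L : Finset (Fin (n ^ 2) → Bool))
    (hcomplete : ∀ E : Finset (Finset (Fin (n ^ 2))),
      (∀ e ∈ E, e.card = n) → E.card ≤ q →
      ∃ χ ∈ L, ∀ e ∈ E, ∃ x ∈ e, ∃ y ∈ e, χ x ≠ χ y) :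
    ((q : ℝ) / (10 * (n : ℝ) ^ 2 * 2 ^ n)) * ((n ^ 2).choose n) ≤
      ((((Finset.univ : Finset (Fin (n ^ 2))).powersetCard n).filter
        (fun e => ∃ χ ∈ L, ∀ x ∈ e, ∀ y ∈ e, χ x = χ y)).card : ℝ) := by
  obtain ⟨χ₀, hχ₀, -⟩ := hcomplete ∅ (by simp) (by simp)
  set D := ((Finset.univ : Finset (Fin (n ^ 2))).powersetCard n).filter
    (fun e => ∃ χ ∈ L, ∀ x ∈ e, ∀ y ∈ e, χ x = χ y)
  set M := ((n ^ 2 + 1) / 2).choose n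
  have hM : ∀ χ ∈ L, M ≤ (D.filter (fun e => ∀ x ∈ e, ∀ y ∈ e, χ x = χ y)).card := by
    intro χ hχ
    refine (choose_le_card_monochromatic n χ).trans (Finset.card_le_card fun e he => ?_)
    rw [Finset.mem_filter] at he
    exact Finset.mem_filter.2 ⟨Finset.mem_filter.2 ⟨he.1, χ, hχ, he.2⟩, he.2⟩
  have hMD : M ≤ D.card := (hM χ₀ hχ₀).trans (Finset.card_filter_le _ _)
  have hM0 : 0 < M := by
    have : 2 * n ≤ n ^ 2 := by nlinarith
    exact Nat.choose_pos (by omega)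
  have hD0 : 0 < D.card := hM0.trans_le hMD
  have hpow := card_pow_le_of_forall_exists_unrelated
    (fun (χ : Fin (n ^ 2) → Bool) (e : Finset (Fin (n ^ 2))) => ∀ x ∈ e, ∀ y ∈ e, χ x = χ y)
    L D M (Finset.card_pos.1 hD0) hMD (fun χ hχ => by convert hM χ hχ) q
    (fun E hED hEq => by
      obtain ⟨χ, hχ, hvalid⟩ := hcomplete E
        (fun e he => (Finset.mem_powersetCard.1 (Finset.mem_filter.1 (hED he)).1).2) hEq
      refine ⟨χ, hχ, fun e he hmono => ?_⟩
      obtain ⟨x, hx, y, hy, hxy⟩ := hvalid e he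
      exact hxy (hmono x hx y hy))
  have hL : L.card ≤ 2 ^ n ^ 2 := by
    simpa using Finset.card_le_univ L
  have hD0' : (0 : ℝ) < D.card := by exact_mod_cast hD0
  have hMD' : (M : ℝ) ≤ D.card := by exact_mod_cast hMD
  have hbound : (q : ℝ) * M ≤ (n ^ 2 : ℕ) * D.card := by
    refine mul_le_mul_of_pow_le_sub_pow_mul_two_pow hD0' hMD' (hpow.trans ?_)
    exact mul_le_mul_of_nonneg_left (by exact_mod_cast hL) (pow_nonneg (by linarith) q)
  have hchoose : ((n ^ 2).choose n : ℝ) ≤ 2 * 2 ^ n * (M : ℝ) :=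
    choose_sq_le_two_pow_mul_choose (by omega) (by omega)
  have hn0 : (0 : ℝ) < n := by exact_mod_cast (by omega : 0 < n)
  push_cast at hbound
  rw [div_mul_eq_mul_div, div_le_iff₀ (by positivity)]
  calc (q : ℝ) * ((n ^ 2).choose n) ≤ q * (2 * 2 ^ n * M) := by gcongr
    _ = 2 * 2 ^ n * (q * M) := by ring
    _ ≤ 2 * 2 ^ n * ((n : ℝ) ^ 2 * D.card) := by gcongr
    _ ≤ 10 * 2 ^ n * ((n : ℝ) ^ 2 * D.card) := by gcongr; norm_num
    _ = D.card * (10 * (n : ℝ) ^ 2 * 2 ^ n) := by ring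
end

section
/- For every real constant c ≥ 1 there is an integer n₀ such that for all integers n ≥ n₀ and all integers v with n ≤ v ≤ n^c the following holds. Let 𝓗 be the collection of all n-uniform hypergraphs on [v] with at most ⌊2^{n/2}⌋ hyperedges. There exist a finite set M with |M| ≤ 2^n and functions A: 𝓗 → M and f: M × 𝓗 → (two-colorings of [v]) such that for all H_A, H_B ∈ 𝓗, the coloring f(A(H_A), H_B) is valid for H_A ∪ H_B. (That is, the one-round two-player communication complexity of two-coloring n-uniform hypergraphs on [v] with at most 2^{n/2} hyperedges is at most n bits.) -/
open scoped Classical in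
/-- Union bound: tuples all of whose entries are bad for a common index are rare. -/
theorem card_exists_forall_le {H Ω : Type*} [Fintype H] [Fintype Ω] (R : H → Ω → Prop) (a : ℝ)
    (hR : ∀ h, ((Finset.univ.filter (R h)).card : ℝ) ≤ a * Fintype.card Ω) (k : ℕ) :
    ((Finset.univ.filter fun t : Fin k → Ω => ∃ h, ∀ i, R h (t i)).card : ℝ) ≤
      Fintype.card H * a ^ k * (Fintype.card Ω : ℝ) ^ k := by
  have hsub : (Finset.univ.filter fun t : Fin k → Ω => ∃ h, ∀ i, R h (t i)) ⊆
      Finset.univ.biUnion fun h => Fintype.piFinset fun _ : Fin k => Finset.univ.filter (R h) := by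
    intro t ht
    simpa [Fintype.mem_piFinset] using ht
  calc ((Finset.univ.filter fun t : Fin k → Ω => ∃ h, ∀ i, R h (t i)).card : ℝ)
      ≤ ((∑ h, (Fintype.piFinset fun _ : Fin k => Finset.univ.filter (R h)).card : ℕ) : ℝ) :=
        mod_cast (Finset.card_le_card hsub).trans Finset.card_biUnion_le
    _ = ∑ h, ((Finset.univ.filter (R h)).card : ℝ) ^ k := by simp [Fintype.card_piFinset]
    _ ≤ ∑ _h : H, (a * Fintype.card Ω) ^ k := by
        gcongr with h
        exact hR h
    _ = _ := by simp [mul_pow, mul_assoc]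

open scoped Classical in
/-- A union bound for two layers of tuples: there are `m` tuples of `k` points such that each index
is avoided by all entries of some tuple, which in turn is not entirely bad for any index. -/
theorem exists_tuples {H Ω : Type*} [Fintype H] [Fintype Ω] [Nonempty Ω] (R : H → Ω → Prop)
    (p X : ℝ) (hp : p ≤ 1) (hX : (Fintype.card H : ℝ) ≤ X)
    (hR : ∀ h, ((Finset.univ.filter (R h)).card : ℝ) ≤ p * Fintype.card Ω) (k m : ℕ)
    (hkm : X * (1 - (1 - p) ^ k + X * p ^ k) ^ m < 1) :
    ∃ S : Fin m → Fin k → Ω, ∀ h, ∃ i, (∀ j, ¬ R h (S i j)) ∧ ∀ h', ∃ j, ¬ R h' (S i j) := by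
  have hΩ : (0 : ℝ) < Fintype.card Ω := by exact_mod_cast Fintype.card_pos
  rcases isEmpty_or_nonempty H with hH | ⟨⟨h₀⟩⟩
  · exact ⟨fun _ _ => Classical.arbitrary Ω, fun h => hH.elim h⟩
  have hp0 : 0 ≤ p := by
    have := (Nat.cast_nonneg _).trans (hR h₀)
    exact nonneg_of_mul_nonneg_left this hΩ
  set b : ℝ := 1 - (1 - p) ^ k + X * p ^ k with hb
  have hX0 : 0 ≤ X := (Nat.cast_nonneg _).trans hX
  have hb0 : 0 ≤ b := by
    have : (1 - p) ^ k ≤ 1 := pow_le_one₀ (by linarith) (by linarith)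
    have : 0 ≤ X * p ^ k := by positivity
    linarith
  obtain ⟨Q, hQiff⟩ : ∃ Q : H → (Fin k → Ω) → Prop, ∀ h t, Q h t ↔
      ¬ ((∀ j, ¬ R h (t j)) ∧ ∀ h', ∃ j, ¬ R h' (t j)) := ⟨_, fun _ _ => Iff.rfl⟩
  have hQ : ∀ h, ((Finset.univ.filter (Q h)).card : ℝ) ≤ b * Fintype.card (Fin k → Ω) := by
    intro h
    have hgood : (Finset.univ.filter fun t : Fin k → Ω => ∀ j, ¬ R h (t j)) =
        Fintype.piFinset fun _ : Fin k => Finset.univ.filter fun ω => ¬ R h ω := by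
      ext t
      simp [Fintype.mem_piFinset]
    have hcompl : ((Finset.univ.filter fun ω => ¬ R h ω).card : ℝ) ≥ (1 - p) * Fintype.card Ω := by
      have := Finset.card_filter_add_card_filter_not (s := (Finset.univ : Finset Ω)) (R h)
      rw [Finset.card_univ] at this
      have h2 : ((Finset.univ.filter (R h)).card : ℝ) +
        (Finset.univ.filter fun ω => ¬ R h ω).card = Fintype.card Ω := by exact_mod_cast this
      linarith [hR h]
    have hgoodcard : ((Finset.univ.filter fun t : Fin k → Ω => ∀ j, ¬ R h (t j)).card : ℝ) ≥
        (1 - p) ^ k * (Fintype.card Ω : ℝ) ^ k := by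
      rw [hgood, Fintype.card_piFinset_const, Nat.cast_pow, ← mul_pow]
      exact pow_le_pow_left₀ (mul_nonneg (by linarith) hΩ.le) hcompl k
    have hbad : ((Finset.univ.filter fun t : Fin k → Ω => ¬ ∀ j, ¬ R h (t j)).card : ℝ) ≤
        (1 - (1 - p) ^ k) * (Fintype.card Ω : ℝ) ^ k := by
      have := Finset.card_filter_add_card_filter_not (s := (Finset.univ : Finset (Fin k → Ω)))
        (fun t => ∀ j, ¬ R h (t j))
      rw [Finset.card_univ, Fintype.card_pi_const] at this
      have h2 : ((Finset.univ.filter fun t : Fin k → Ω => ∀ j, ¬ R h (t j)).card : ℝ) +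
        (Finset.univ.filter fun t : Fin k → Ω => ¬ ∀ j, ¬ R h (t j)).card =
          (Fintype.card Ω : ℝ) ^ k := by exact_mod_cast this
      linarith
    have hall := card_exists_forall_le R p hR k
    have hsub : Finset.univ.filter (Q h) ⊆
        (Finset.univ.filter fun t : Fin k → Ω => ¬ ∀ j, ¬ R h (t j)) ∪
          Finset.univ.filter fun t : Fin k → Ω => ∃ h, ∀ i, R h (t i) := by
      intro t ht
      simp only [Finset.mem_filter, Finset.mem_univ, true_and, Finset.mem_union, hQiff] at ht ⊢
      by_contra! hcon
      exact ht hcon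
    have hcard : ((Finset.univ.filter (Q h)).card : ℝ) ≤
        (Finset.univ.filter fun t : Fin k → Ω => ¬ ∀ j, ¬ R h (t j)).card +
          (Finset.univ.filter fun t : Fin k → Ω => ∃ h, ∀ i, R h (t i)).card := by
      exact_mod_cast (Finset.card_le_card hsub).trans (Finset.card_union_le _ _)
    have hmono : (Fintype.card H : ℝ) * p ^ k * (Fintype.card Ω : ℝ) ^ k ≤
        X * p ^ k * (Fintype.card Ω : ℝ) ^ k := by gcongr
    rw [Fintype.card_pi_const, Nat.cast_pow, hb]
    linarith
  have hfinal := card_exists_forall_le Q b hQ m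
  have hlt : ((Finset.univ.filter fun t : Fin m → Fin k → Ω => ∃ h, ∀ i, Q h (t i)).card : ℝ) <
      (Fintype.card (Fin m → Fin k → Ω) : ℝ) := by
    rw [Fintype.card_pi_const, Nat.cast_pow]
    have hT : (0 : ℝ) < (Fintype.card (Fin k → Ω) : ℝ) ^ m :=
      pow_pos (by exact_mod_cast Fintype.card_pos) m
    have h1 : (Fintype.card H : ℝ) * b ^ m < 1 :=
      (mul_le_mul_of_nonneg_right hX (pow_nonneg hb0 m)).trans_lt hkm
    exact hfinal.trans_lt ((mul_lt_mul_of_pos_right h1 hT).trans_eq (one_mul _))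
  obtain ⟨S, hS⟩ : ∃ S : Fin m → Fin k → Ω, ¬ ∃ h, ∀ i, Q h (S i) := by
    by_contra! hcon
    have : (Finset.univ.filter fun t : Fin m → Fin k → Ω => ∃ h, ∀ i, Q h (t i)) = Finset.univ :=
      Finset.filter_true_of_mem fun t _ => hcon t
    rw [this, Finset.card_univ] at hlt
    exact lt_irrefl _ hlt
  refine ⟨S, fun h => ?_⟩
  by_contra! hcon
  refine hS ⟨h, fun i => (hQiff _ _).2 fun hi => ?_⟩
  obtain ⟨h', hh'⟩ := hcon i hi.1
  obtain ⟨j, hj⟩ := hi.2 h'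
  exact hj (hh' j)

/-- The edge `e` is monochromatic under the coloring `χ`. -/
def IsMonochromatic {V : Type*} (e : Finset V) (χ : V → Bool) : Prop :=
  ∃ b, ∀ x ∈ e, χ x = b

theorem exists_ne_of_not_isMonochromatic {V : Type*} {e : Finset V} {χ : V → Bool}
    (h : ¬ IsMonochromatic e χ) : ∃ x ∈ e, ∃ y ∈ e, χ x ≠ χ y := by
  by_contra! hcon
  rcases e.eq_empty_or_nonempty with rfl | ⟨x, hx⟩
  · exact h ⟨true, by simp⟩
  · exact h ⟨χ x, fun y hy => hcon y hy x hx⟩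

open scoped Classical in
theorem card_isMonochromatic_le {V : Type*} [Fintype V] [DecidableEq V] (e : Finset V) :
    ((Finset.univ.filter (IsMonochromatic e)).card : ℝ) ≤
      2 / 2 ^ e.card * Fintype.card (V → Bool) := by
  have hsub : Finset.univ.filter (IsMonochromatic e) ⊆ Finset.univ.biUnion fun b : Bool =>
      Fintype.piFinset fun x => if x ∈ e then {b} else Finset.univ := by
    intro χ hχ
    obtain ⟨b, hb⟩ := (Finset.mem_filter.1 hχ).2
    simp only [Finset.mem_biUnion, Finset.mem_univ, true_and, Fintype.mem_piFinset]
    refine ⟨b, fun x => ?_⟩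
    by_cases hx : x ∈ e <;> simp [hx, hb]
  have hpi : ∀ b : Bool, (Fintype.piFinset fun x : V =>
      if x ∈ e then ({b} : Finset Bool) else Finset.univ).card = 2 ^ (eᶜ).card := by
    intro b
    rw [Fintype.card_piFinset]
    have : ∀ x : V, (if x ∈ e then ({b} : Finset Bool) else Finset.univ).card =
        if x ∈ e then 1 else 2 := by
      intro x
      split_ifs <;> simp
    simp only [this]
    rw [Finset.prod_ite]
    simp [Finset.filter_not, Finset.compl_eq_univ_sdiff]
  have hle : (Finset.univ.filter (IsMonochromatic e)).card ≤ 2 * 2 ^ (eᶜ).card := by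
    refine ((Finset.card_le_card hsub).trans Finset.card_biUnion_le).trans_eq ?_
    simp only [hpi]
    simp
  have hle' : ((Finset.univ.filter (IsMonochromatic e)).card : ℝ) ≤ 2 * 2 ^ (eᶜ).card := by
    exact_mod_cast hle
  refine hle'.trans_eq ?_
  rw [Fintype.card_fun, Fintype.card_bool, ← Finset.card_add_card_compl e]
  push_cast
  rw [pow_add]
  field_simp

/-- A family with at most `q` members is covered by the range of a `q`-tuple. -/
theorem exists_tuple_covering {E : Type*} [Nonempty E] (s : Finset E) {q : ℕ} (hs : s.card ≤ q) :
    ∃ h : Fin q → E, ∀ e ∈ s, ∃ i, h i = e := by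
  refine ⟨fun i => if hi : i.1 < s.card then (s.equivFin.symm ⟨i, hi⟩ : E)
    else Classical.arbitrary E, fun e he => ?_⟩
  refine ⟨Fin.castLE hs (s.equivFin ⟨e, he⟩), ?_⟩
  simp

open Filter Asymptotics in
theorem eventually_mul_log_lt (c : ℝ) (hc : 1 ≤ c) :
    ∀ᶠ n : ℕ in atTop, c * n * Real.log n <
      (2 : ℝ) ^ ((n : ℝ) / 2) * (Real.exp (-(32 * c * Real.log n) - 2) / 2) := by
  have hb : (0 : ℝ) < Real.log 2 / 2 := by positivity
  have ho := (isLittleO_rpow_exp_pos_mul_atTop (32 * c + 2) hb).comp_tendsto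
    tendsto_natCast_atTop_atTop
  have hC : (0 : ℝ) < Real.exp (-2) / (4 * c) := by positivity
  filter_upwards [ho.bound hC, eventually_ge_atTop 1] with n hn hn1
  have hn0 : (0 : ℝ) < n := by exact_mod_cast hn1
  have hs : (2 : ℝ) ^ ((n : ℝ) / 2) = Real.exp (Real.log 2 / 2 * n) := by
    rw [Real.rpow_def_of_pos two_pos]
    ring_nf
  have he : Real.exp (-(32 * c * Real.log n) - 2) = Real.exp (-2) / (n : ℝ) ^ (32 * c) := by
    rw [Real.rpow_def_of_pos hn0, ← Real.exp_sub]
    ring_nf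
  simp only [Function.comp_apply, Real.norm_eq_abs, Real.abs_exp] at hn
  rw [abs_of_nonneg (by positivity), Real.rpow_add hn0, Real.rpow_two] at hn
  rw [hs, he]
  set Y := (n : ℝ) ^ (32 * c)
  have hY : 0 < Y := by positivity
  have hlog : Real.log n ≤ n := (Real.log_le_sub_one_of_pos hn0).trans (by linarith)
  set s := Real.exp (Real.log 2 / 2 * n)
  have hspos : 0 < s := Real.exp_pos _
  calc c * n * Real.log n ≤ c * n * n := by gcongr
    _ = c * (Y * n ^ 2) / Y := by field_simp
    _ ≤ c * (Real.exp (-2) / (4 * c) * s) / Y := by gcongr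
    _ = s * (Real.exp (-2) / Y / 4) := by field_simp
    _ < s * (Real.exp (-2) / Y / 2) := by
        have : 0 < Real.exp (-2) / Y := by positivity
        gcongr
        norm_num

theorem exp_neg_two_mul_le_one_sub {p : ℝ} (h0 : 0 ≤ p) (h1 : p ≤ 1 / 2) :
    Real.exp (-(2 * p)) ≤ 1 - p := by
  rw [Real.exp_neg]
  have h2 : 2 * p + 1 ≤ Real.exp (2 * p) := Real.add_one_le_exp _
  refine (inv_anti₀ (by linarith) h2).trans ?_
  rw [inv_le_iff_one_le_mul₀ (by linarith)]
  nlinarith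

theorem exists_tuple_length {c s : ℝ} (hc : 1 ≤ c) {n : ℕ} (hn : 100 ≤ n)
    (hs : s = (2 : ℝ) ^ ((n : ℝ) / 2))
    (hlt : c * n * Real.log n < s * (Real.exp (-(32 * c * Real.log n) - 2) / 2)) :
    2 / s ≤ 1 ∧ ∃ k : ℕ, Real.exp (c * n * Real.log n * s) *
      (1 - (1 - 2 / s) ^ k + Real.exp (c * n * Real.log n * s) * (2 / s) ^ k) ^ (2 ^ n) < 1 := by
  have hn' : (100 : ℝ) ≤ n := by exact_mod_cast hn
  have hs4 : 4 ≤ s := by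
    rw [hs]
    calc (4 : ℝ) = 2 ^ (2 : ℝ) := by norm_num
      _ ≤ _ := Real.rpow_le_rpow_of_exponent_le (by norm_num) (by linarith)
  have hss : s * s = ((2 ^ n : ℕ) : ℝ) := by
    rw [hs, ← Real.rpow_add two_pos, add_halves, Real.rpow_natCast]
    norm_cast
  have hL : 1 ≤ Real.log n := by
    rw [Real.le_log_iff_exp_le (by linarith)]
    linarith [Real.exp_one_lt_three]
  set L := Real.log n
  have hp0 : 0 < 2 / s := by positivity
  have hp2 : 2 / s ≤ 1 / 2 := by
    rw [div_le_div_iff₀ (by linarith) (by norm_num)]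
    linarith
  have hpexp : 2 / s ≤ Real.exp (-(n * Real.log 2 / 4)) := by
    have : 2 / s = Real.exp (Real.log 2 - n * Real.log 2 / 2) := by
      rw [Real.exp_sub, Real.exp_log two_pos, hs, Real.rpow_def_of_pos two_pos]
      ring_nf
    rw [this, Real.exp_le_exp]
    nlinarith [Real.log_two_gt_d9]
  refine ⟨by linarith, ⌈8 * c * s * L⌉₊, ?_⟩
  set k := ⌈8 * c * s * L⌉₊
  have hk1 : 8 * c * s * L ≤ k := Nat.le_ceil _
  have hk2 : (k : ℝ) < 8 * c * s * L + 1 := Nat.ceil_lt_add_one (by positivity)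
  set p := 2 / s
  set D := Real.exp (-(32 * c * L) - 2) / 2 with hD
  have hcL : 1 ≤ c * L := one_le_mul_of_one_le_of_one_le hc hL
  have hgood : 2 * D ≤ (1 - p) ^ k := by
    have hpk : p * k ≤ 16 * c * L + 1 := by
      calc p * k ≤ p * (8 * c * s * L + 1) := by gcongr
        _ = 16 * c * L + p := by
          simp only [p]
          field_simp
          ring
        _ ≤ _ := by linarith
    calc 2 * D = Real.exp (-(32 * c * L) - 2) := by rw [hD]; ring
      _ ≤ Real.exp (k * -(2 * p)) := by
          rw [Real.exp_le_exp]
          linarith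
      _ = Real.exp (-(2 * p)) ^ k := Real.exp_nat_mul _ _
      _ ≤ _ := by
          gcongr
          exact exp_neg_two_mul_le_one_sub hp0.le hp2
  have hbad : Real.exp (c * n * L * s) * p ^ k ≤ D := by
    have hlog2 : Real.log 2 ≤ 1 := by linarith [Real.log_two_lt_d9]
    have hkn : 8 * c * s * L * (n * Real.log 2 / 4) ≤ k * (n * Real.log 2 / 4) := by
      have : 0 ≤ n * Real.log 2 / 4 := by positivity
      gcongr
    have hns : 400 ≤ n * s := by nlinarith
    have h1 : 400 * (c * L) ≤ n * s * (c * L) := by gcongr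
    have h2 : n * s * (c * L) * (0.69) ≤ n * s * (c * L) * Real.log 2 := by
      have := Real.log_two_gt_d9
      gcongr
      linarith
    calc Real.exp (c * n * L * s) * p ^ k
        ≤ Real.exp (c * n * L * s) * Real.exp (-(n * Real.log 2 / 4)) ^ k := by gcongr
      _ = Real.exp (c * n * L * s + k * -(n * Real.log 2 / 4)) := by
          rw [← Real.exp_nat_mul, ← Real.exp_add]
      _ ≤ Real.exp (-(32 * c * L) - 2 - Real.log 2) := by
          rw [Real.exp_le_exp]
          linarith
      _ = D := by rw [Real.exp_sub _ (Real.log 2), Real.exp_log two_pos]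
  set X := Real.exp (c * n * L * s) with hX
  have hbase : 1 - (1 - p) ^ k + X * p ^ k ≤ Real.exp (-D) := by
    linarith [Real.add_one_le_exp (-D)]
  have hbase0 : 0 ≤ 1 - (1 - p) ^ k + X * p ^ k := by
    have : (1 - p) ^ k ≤ 1 := pow_le_one₀ (by linarith) (by linarith)
    have : 0 ≤ X * p ^ k := by positivity
    linarith
  calc X * (1 - (1 - p) ^ k + X * p ^ k) ^ (2 ^ n)
      ≤ X * Real.exp (-D) ^ (2 ^ n) := by gcongr
    _ = Real.exp (s * (c * n * L - s * D)) := by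
        rw [← Real.exp_nat_mul, hX, ← Real.exp_add, ← hss]
        ring_nf
    _ < 1 := by
        rw [Real.exp_lt_one_iff]
        exact mul_neg_of_pos_of_neg (by linarith) (by linarith)

theorem one_round_protocol_upper_bound :
    ∀ c : ℝ, 1 ≤ c → ∃ n₀ : ℕ, ∀ n : ℕ, n₀ ≤ n → ∀ v : ℕ, n ≤ v → (v : ℝ) ≤ (n : ℝ) ^ c →
    ∃ m : ℕ, m ≤ 2 ^ n ∧
    ∃ (A : Finset (Finset (Fin v)) → Fin m)
      (f : Fin m → Finset (Finset (Fin v)) → (Fin v → Bool)),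
      ∀ HA HB : Finset (Finset (Fin v)),
        (∀ e ∈ HA, e.card = n) → HA.card ≤ ⌊(2 : ℝ) ^ ((n : ℝ) / 2)⌋₊ →
        (∀ e ∈ HB, e.card = n) → HB.card ≤ ⌊(2 : ℝ) ^ ((n : ℝ) / 2)⌋₊ →
        ∀ e ∈ HA ∪ HB, ∃ x ∈ e, ∃ y ∈ e, f (A HA) HB x ≠ f (A HA) HB y := by
  classical
  intro c hc
  obtain ⟨n₁, hn₁⟩ := Filter.eventually_atTop.1 (eventually_mul_log_lt c hc)
  refine ⟨max n₁ 100, fun n hn v hnv hvc => ⟨2 ^ n, le_rfl, ?_⟩⟩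
  obtain ⟨hn1, hn100⟩ := max_le_iff.1 hn
  have hn0 : (0 : ℝ) < n := by exact_mod_cast (by omega : 0 < n)
  have hv0 : (0 : ℝ) < v := by exact_mod_cast (by omega : 0 < v)
  obtain ⟨hp, k, hk⟩ := exists_tuple_length hc hn100 rfl (hn₁ n hn1)
  set s : ℝ := (2 : ℝ) ^ ((n : ℝ) / 2) with hs
  have hs0 : 0 < s := by positivity
  have hss : s * s = 2 ^ n := by
    rw [hs, ← Real.rpow_add two_pos, add_halves, Real.rpow_natCast]
  have hqs : (⌊s⌋₊ : ℝ) ≤ s := Nat.floor_le hs0.le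
  set q := ⌊s⌋₊
  let E := {e : Finset (Fin v) // e.card = n}
  have hE : Nonempty E := by
    obtain ⟨e, -, he⟩ := Finset.exists_subset_card_eq
      (s := (Finset.univ : Finset (Fin v))) (n := n) (by simpa using hnv)
    exact ⟨⟨e, he⟩⟩
  obtain ⟨R, hRiff⟩ : ∃ R : (Fin q → E) → (Fin v → Bool) → Prop, ∀ h χ, R h χ ↔
      ∃ i, IsMonochromatic (h i).1 χ := ⟨_, fun _ _ => Iff.rfl⟩
  have hR : ∀ h, ((Finset.univ.filter (R h)).card : ℝ) ≤
      2 / s * Fintype.card (Fin v → Bool) := by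
    intro h
    have hsub : Finset.univ.filter (R h) ⊆ Finset.univ.biUnion fun i =>
        Finset.univ.filter (IsMonochromatic (h i).1) := by
      intro χ hχ
      simpa [hRiff] using hχ
    calc ((Finset.univ.filter (R h)).card : ℝ)
        ≤ ((∑ i, (Finset.univ.filter (IsMonochromatic (h i).1)).card : ℕ) : ℝ) :=
          mod_cast (Finset.card_le_card hsub).trans Finset.card_biUnion_le
      _ = ∑ i, ((Finset.univ.filter (IsMonochromatic (h i).1)).card : ℝ) := by push_cast; rfl
      _ ≤ ∑ _i : Fin q, 2 / 2 ^ n * (Fintype.card (Fin v → Bool) : ℝ) := by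
          refine Finset.sum_le_sum fun i _ => ?_
          have := card_isMonochromatic_le (h i).1
          rwa [(h i).2] at this
      _ = q * (2 / 2 ^ n * (Fintype.card (Fin v → Bool) : ℝ)) := by simp
      _ ≤ s * (2 / 2 ^ n * (Fintype.card (Fin v → Bool) : ℝ)) := by gcongr
      _ = _ := by
          rw [← hss]
          field_simp
  have hX : (Fintype.card (Fin q → E) : ℝ) ≤ Real.exp (c * n * Real.log n * s) := by
    have hcardE : Fintype.card E ≤ v ^ n := by
      rw [Fintype.card_finset_len, Fintype.card_fin]
      exact Nat.choose_le_pow v n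
    have hlogv : Real.log v ≤ c * Real.log n := by
      rw [← Real.log_rpow hn0]
      exact Real.log_le_log hv0 hvc
    have hlogn : 0 ≤ Real.log n := Real.log_natCast_nonneg n
    rw [Fintype.card_pi_const, Nat.cast_pow]
    calc (Fintype.card E : ℝ) ^ q ≤ ((v : ℝ) ^ n) ^ q := by
          gcongr
          exact_mod_cast hcardE
      _ = Real.exp (q * (n * Real.log v)) := by
          rw [Real.exp_nat_mul, Real.exp_nat_mul, Real.exp_log hv0]
      _ ≤ Real.exp (s * (n * (c * Real.log n))) := by gcongr
      _ = _ := by ring_nf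
  obtain ⟨S, hS⟩ := exists_tuples R (2 / s) _ hp hX hR k (2 ^ n) hk
  have hcover : ∀ H : Finset (Finset (Fin v)), (∀ e ∈ H, e.card = n) → H.card ≤ q →
      ∃ h : Fin q → E, ∀ χ, ¬ R h χ → ∀ e ∈ H, ∃ x ∈ e, ∃ y ∈ e, χ x ≠ χ y := by
    intro H hH hHq
    obtain ⟨h, hh⟩ := exists_tuple_covering (H.subtype fun e => e.card = n)
      ((Finset.card_subtype _ _).trans_le ((Finset.card_filter_le _ _).trans hHq))
    refine ⟨h, fun χ hχ e he => exists_ne_of_not_isMonochromatic fun hmono => hχ ?_⟩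
    obtain ⟨i, hi⟩ := hh ⟨e, hH e he⟩ (by simpa using he)
    exact (hRiff _ _).2 ⟨i, by rwa [hi]⟩
  have hA : ∀ HA : Finset (Finset (Fin v)), ∃ i : Fin (2 ^ n), (∀ e ∈ HA, e.card = n) →
      HA.card ≤ q → (∀ j, ∀ e ∈ HA, ∃ x ∈ e, ∃ y ∈ e, S i j x ≠ S i j y) ∧
        ∀ h', ∃ j, ¬ R h' (S i j) := by
    intro HA
    by_cases hHA : (∀ e ∈ HA, e.card = n) ∧ HA.card ≤ q
    · obtain ⟨h, hh⟩ := hcover HA hHA.1 hHA.2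
      obtain ⟨i, hi, hi'⟩ := hS h
      exact ⟨i, fun _ _ => ⟨fun j => hh _ (hi j), hi'⟩⟩
    · exact ⟨⟨0, by positivity⟩, fun h1 h2 => (hHA ⟨h1, h2⟩).elim⟩
  choose A hA using hA
  have hf : ∀ (i : Fin (2 ^ n)) (HB : Finset (Finset (Fin v))), ∃ χ : Fin v → Bool,
      (∀ h', ∃ j, ¬ R h' (S i j)) → (∀ e ∈ HB, e.card = n) → HB.card ≤ q →
        (∃ j, χ = S i j) ∧ ∀ e ∈ HB, ∃ x ∈ e, ∃ y ∈ e, χ x ≠ χ y := by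
    intro i HB
    by_cases hHB : (∀ h', ∃ j, ¬ R h' (S i j)) ∧ (∀ e ∈ HB, e.card = n) ∧ HB.card ≤ q
    · obtain ⟨h, hh⟩ := hcover HB hHB.2.1 hHB.2.2
      obtain ⟨j, hj⟩ := hHB.1 h
      exact ⟨S i j, fun _ _ _ => ⟨⟨j, rfl⟩, hh _ hj⟩⟩
    · exact ⟨fun _ => true, fun h1 h2 h3 => (hHB ⟨h1, h2, h3⟩).elim⟩
  choose f hf using hf
  refine ⟨A, f, fun HA HB hA1 hA2 hB1 hB2 e he => ?_⟩
  obtain ⟨hvalid, hhit⟩ := hA HA hA1 hA2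
  obtain ⟨⟨j, hj⟩, hfB⟩ := hf (A HA) HB hhit hB1 hB2
  rcases Finset.mem_union.1 he with he | he
  · rw [hj]
    exact hvalid j e he
  · exact hfB e he
end
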